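/- arXiv:1108.1737 — 7 statements merged into one kernel-verified Lean document; each statement's English description precedes it below -/
import Mathlib

section
/- For all positive integers d and α, the reduction number of the full Veronese ring K[B_{d,α}] equals ⌊d − d/α⌋; that is, max{(x_1 + … + x_d)/α : x ∈ (B_{d,α})_A} = ⌊d − d/α⌋, where (B_{d,α})_A is the set of elements x of B_{d,α} such that x − e_i ∉ B_{d,α} for all i = 1, …, d. -/
/-- `e_i := α · (i-th standard basis vector)`, viewed in `ℤ^d`. -/
def stdGen (d α : ℕ) (i : Fin d) : Fin d → ℤ := fun j => if j = i then (α : ℤ) else 0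

/-- `B_{d,α}`: the submonoid generated by all lattice points of `ℕ^d` (viewed inside `ℤ^d`)
with coordinate sum `α`. -/
def verB (d α : ℕ) : AddSubmonoid (Fin d → ℤ) :=
  AddSubmonoid.closure {u : Fin d → ℤ | (∀ j, 0 ≤ u j) ∧ ∑ j, u j = (α : ℤ)}

/-- `(B_{d,α})_A`: the elements `x` of `B_{d,α}` with `x - e_i ∉ B_{d,α}` for all `i`. -/
def verBA (d α : ℕ) : Set (Fin d → ℤ) :=
  {x | x ∈ verB d α ∧ ∀ i : Fin d, x - stdGen d α i ∉ verB d α}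

/-- A nonnegative integer vector dominates nonnegative vectors of every intermediate sum. -/
theorem exists_nonneg_le_sum_eq {n : ℕ} (c : Fin n → ℤ) (hc : ∀ j, 0 ≤ c j) (s : ℤ)
    (hs : 0 ≤ s) (hsc : s ≤ ∑ j, c j) :
    ∃ x : Fin n → ℤ, (∀ j, 0 ≤ x j) ∧ (∀ j, x j ≤ c j) ∧ ∑ j, x j = s := by
  induction n generalizing s with
  | zero =>
    refine ⟨c, hc, fun _ => le_rfl, ?_⟩
    simp only [Finset.univ_eq_empty, Finset.sum_empty] at hsc ⊢
    lia
  | succ n ih =>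
    rw [Fin.sum_univ_succ] at hsc
    have hc₀ := hc 0
    obtain ⟨y, hy₀, hyc, hys⟩ := ih (fun j => c j.succ) (fun j => hc j.succ) (s - min s (c 0))
      (by lia) (by have := Finset.sum_nonneg fun j (_ : j ∈ Finset.univ) => hc (Fin.succ j); lia)
    refine ⟨Fin.cons (min s (c 0)) y, Fin.forall_fin_succ.2 ⟨?_, ?_⟩,
      Fin.forall_fin_succ.2 ⟨?_, ?_⟩, ?_⟩
    · simp only [Fin.cons_zero]; lia
    · simpa using hy₀
    · simp
    · simpa using hyc
    · simp [Fin.sum_univ_succ, hys]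

/-- The Veronese monoid consists of the nonnegative vectors whose sum is a multiple of `α`. -/
theorem mem_verB_iff {d α : ℕ} {x : Fin d → ℤ} :
    x ∈ verB d α ↔ (∀ j, 0 ≤ x j) ∧ ∃ k : ℕ, ∑ j, x j = k * (α : ℤ) := by
  constructor
  · intro h
    induction h using AddSubmonoid.closure_induction with
    | mem u hu => exact ⟨hu.1, 1, by simpa using hu.2⟩
    | zero => exact ⟨fun _ => le_rfl, 0, by simp⟩
    | add u v _ _ hu hv =>
      obtain ⟨hu, k, hk⟩ := hu
      obtain ⟨hv, l, hl⟩ := hv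
      refine ⟨fun j => add_nonneg (hu j) (hv j), k + l, ?_⟩
      simp only [Pi.add_apply, Finset.sum_add_distrib, hk, hl]
      push_cast
      ring
  · rintro ⟨hx, k, hk⟩
    induction k generalizing x with
    | zero =>
      have h₀ : x = 0 := by
        funext j
        exact (Finset.sum_eq_zero_iff_of_nonneg fun i _ => hx i).1 (by simpa using hk) j
          (Finset.mem_univ j)
      exact h₀ ▸ zero_mem _
    | succ k ih =>
      have hkα : (0 : ℤ) ≤ k * (α : ℤ) := by positivity
      push_cast at hk
      obtain ⟨u, hu, hux, hus⟩ := exists_nonneg_le_sum_eq x hx α (by positivity) (by linarith)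
      rw [← sub_add_cancel x u]
      refine add_mem (ih (fun j => sub_nonneg.2 (hux j)) ?_) (AddSubmonoid.subset_closure ⟨hu, hus⟩)
      simp only [Pi.sub_apply, Finset.sum_sub_distrib, hk, hus]
      ring

theorem sum_stdGen (d α : ℕ) (i : Fin d) : ∑ j, stdGen d α i j = α := by
  simp [stdGen]

/-- An element of the Veronese monoid lies in `verBA` exactly when all its coordinates are
less than `α`. -/
theorem mem_verBA_iff {d α : ℕ} {x : Fin d → ℤ} :
    x ∈ verBA d α ↔ x ∈ verB d α ∧ ∀ j, x j < α := by
  refine and_congr_right fun hx => forall_congr' fun i => ?_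
  obtain ⟨hx₀, k, hk⟩ := mem_verB_iff.1 hx
  constructor
  · intro h
    by_contra! hi
    have hnonneg : ∀ j, 0 ≤ (x - stdGen d α i) j := by
      intro j
      by_cases hj : j = i
      · subst hj
        simpa [stdGen] using hi
      · simpa [stdGen, hj] using hx₀ j
    have hsum : ∑ j, (x - stdGen d α i) j = k * (α : ℤ) - α := by
      simp only [Pi.sub_apply, Finset.sum_sub_distrib, hk, sum_stdGen]
    refine h (mem_verB_iff.2 ⟨hnonneg, k - 1, ?_⟩)
    rcases k with _ | k
    · have := Finset.sum_nonneg fun j (_ : j ∈ Finset.univ) => hnonneg j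
      simp only [Nat.cast_zero, zero_mul, zero_tsub] at hsum ⊢
      lia
    · rw [hsum]
      push_cast [Nat.add_sub_cancel]
      ring
  · intro hi h
    have := (mem_verB_iff.1 h).1 i
    simp only [Pi.sub_apply, stdGen, if_true] at this
    lia

/-- The reduction number of the full Veronese ring `K[B_{d,α}]`, i.e. the maximum of
`deg x = (x_1 + ⋯ + x_d)/α` over `x ∈ (B_{d,α})_A`, equals `⌊d - d/α⌋`. -/
theorem reductionNumber_veronese (d α : ℕ) (hd : 0 < d) (hα : 0 < α) :
    IsGreatest {r : ℤ | ∃ x ∈ verBA d α, ∑ j, x j = r * (α : ℤ)}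
      ⌊(d : ℚ) - (d : ℚ) / (α : ℚ)⌋ := by
  have hα' : (0 : ℚ) < α := by exact_mod_cast hα
  have le_floor_iff (r : ℤ) :
      r ≤ ⌊(d : ℚ) - (d : ℚ) / (α : ℚ)⌋ ↔ r * (α : ℤ) ≤ d * ((α : ℤ) - 1) := by
    have h : (d : ℚ) - d / α = d * (α - 1) / α := by field_simp
    rw [Int.le_floor, h, le_div_iff₀ hα']
    exact_mod_cast Iff.rfl
  constructor
  · have hα₁ : (0 : ℤ) ≤ (α : ℤ) - 1 := by lia
    obtain ⟨k, hk⟩ := Int.eq_ofNat_of_zero_le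
      ((le_floor_iff 0).2 (by simp only [zero_mul]; positivity))
    have hle := (le_floor_iff _).1 le_rfl
    rw [hk] at hle ⊢
    obtain ⟨x, hx₀, hxα, hxs⟩ := exists_nonneg_le_sum_eq (fun _ : Fin d => (α : ℤ) - 1)
      (fun _ => hα₁) (k * (α : ℤ)) (by positivity) (by simpa [mul_sub] using hle)
    exact ⟨x, mem_verBA_iff.2 ⟨mem_verB_iff.2 ⟨hx₀, k, hxs⟩, fun j => by have := hxα j; lia⟩, hxs⟩
  · rintro r ⟨x, hx, hr⟩
    rw [le_floor_iff, ← hr]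
    calc ∑ j, x j ≤ ∑ _j : Fin d, ((α : ℤ) - 1) :=
          Finset.sum_le_sum fun j _ => Int.le_sub_one_of_lt ((mem_verBA_iff.1 hx).2 j)
      _ = d * ((α : ℤ) - 1) := by
          rw [Finset.sum_const, Finset.card_univ, Fintype.card_fin, nsmul_eq_mul]
end

section
/- Let d, α be positive integers and r ∈ ℕ. The following are equivalent: (1) rM_{d,α} + {e_1, …, e_d} = (r+1)M_{d,α}, where rM_{d,α} denotes the r-fold sumset of M_{d,α} (with 0·M_{d,α} = {0}) and + denotes the Minkowski sum of subsets of ℕ^d; (2) (r+1)α > d(α − 1). -/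
open Pointwise

/-- `M_{d,α}`: the set of vectors in `ℕ^d` with coordinate sum `α`. -/
def Mda (d α : ℕ) : Set (Fin d → ℕ) := {u | ∑ j, u j = α}

/-- `e_i := α · (i-th standard basis vector of ℕ^d)`. -/
def stdGenN (d α : ℕ) (i : Fin d) : Fin d → ℕ := fun j => if j = i then α else 0

/-- The `n`-fold Minkowski sumset `nX` of a subset of `ℕ^d`, with `0X = {0}`. -/
def sumset (d : ℕ) : ℕ → Set (Fin d → ℕ) → Set (Fin d → ℕ)
  | 0, _ => {0}
  | n + 1, X => X + sumset d n X

/-- Every natural number up to the coordinate sum of `u` is the coordinate sum of some `v ≤ u`. -/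
theorem exists_le_sum_eq_of_le_sum {ι : Type*} [Fintype ι] (u : ι → ℕ) {m : ℕ}
    (hm : m ≤ ∑ j, u j) : ∃ v ≤ u, ∑ j, v j = m := by
  classical
  induction m with
  | zero => exact ⟨0, fun _ => Nat.zero_le _, by simp⟩
  | succ m ih =>
    obtain ⟨v, hv, hs⟩ := ih (by omega)
    obtain ⟨i, -, hi⟩ := Finset.exists_lt_of_sum_lt (s := Finset.univ) (f := v) (g := u) (by omega)
    refine ⟨v + Pi.single i 1, fun j => ?_, ?_⟩
    · by_cases h : j = i
      · subst h
        simpa using hi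
      · simpa [h] using hv j
    · simp [Finset.sum_add_distrib, hs]

theorem mem_Mda {d α : ℕ} {u : Fin d → ℕ} : u ∈ Mda d α ↔ ∑ j, u j = α :=
  Iff.rfl

theorem mem_sumset_Mda {d α n : ℕ} {u : Fin d → ℕ} :
    u ∈ sumset d n (Mda d α) ↔ ∑ j, u j = n * α := by
  induction n generalizing u with
  | zero => simp [sumset, funext_iff]
  | succ n ih =>
    simp only [sumset, Set.mem_add, ih, mem_Mda]
    constructor
    · rintro ⟨x, hx, y, hy, rfl⟩
      simp only [Pi.add_apply, Finset.sum_add_distrib, hx, hy]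
      ring
    · intro hu
      obtain ⟨v, hv, hs⟩ := exists_le_sum_eq_of_le_sum u (m := α) (by rw [hu]; nlinarith)
      have key : v + (u - v) = u := add_tsub_cancel_of_le hv
      refine ⟨v, hs, u - v, ?_, key⟩
      have h : ∑ j, (v + (u - v)) j = (n + 1) * α := by rw [key, hu]
      simp only [Pi.add_apply, Finset.sum_add_distrib, hs] at h
      linarith

theorem sum_stdGenN (d α : ℕ) (i : Fin d) : ∑ j, stdGenN d α i j = α := by
  simp [stdGenN]

theorem mem_sumset_Mda_add_range_stdGenN {d α r : ℕ} {u : Fin d → ℕ} :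
    u ∈ sumset d r (Mda d α) + Set.range (stdGenN d α) ↔
      ∑ j, u j = (r + 1) * α ∧ ∃ i, α ≤ u i := by
  simp only [Set.mem_add, mem_sumset_Mda, Set.exists_range_iff]
  constructor
  · rintro ⟨x, hx, i, rfl⟩
    refine ⟨?_, i, by simp [stdGenN]⟩
    simp only [Pi.add_apply, Finset.sum_add_distrib, hx, sum_stdGenN]
    ring
  · rintro ⟨hu, i, hi⟩
    have hle : stdGenN d α i ≤ u := fun j => by
      by_cases h : j = i
      · subst h
        simpa [stdGenN] using hi
      · simp [stdGenN, h]
    have key : u - stdGenN d α i + stdGenN d α i = u := tsub_add_cancel_of_le hle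
    refine ⟨u - stdGenN d α i, ?_, i, key⟩
    have h : ∑ j, (u - stdGenN d α i + stdGenN d α i) j = (r + 1) * α := by rw [key, hu]
    simp only [Pi.add_apply, Finset.sum_add_distrib, sum_stdGenN] at h
    linarith

theorem sumset_add_std_eq_succ_iff (d α : ℕ) (hd : 0 < d) (hα : 0 < α) (r : ℕ) :
    sumset d r (Mda d α) + Set.range (stdGenN d α) = sumset d (r + 1) (Mda d α) ↔
      (r + 1) * α > d * (α - 1) := by
  simp only [Set.ext_iff, mem_sumset_Mda_add_range_stdGenN, mem_sumset_Mda, and_iff_left_iff_imp]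
  constructor
  · intro h
    by_contra! hle
    obtain ⟨v, hv, hs⟩ := exists_le_sum_eq_of_le_sum (fun _ : Fin d => α - 1)
      (m := (r + 1) * α) (by simpa using hle)
    obtain ⟨i, hi⟩ := h v hs
    have : v i ≤ α - 1 := hv i
    omega
  · intro h u hu
    by_contra! hlt
    have : ∑ j, u j ≤ ∑ _j : Fin d, (α - 1) :=
      Finset.sum_le_sum fun j _ => Nat.le_sub_one_of_lt (hlt j)
    simp only [Finset.sum_const, Finset.card_univ, Fintype.card_fin, smul_eq_mul] at this
    omega
end

section
/- Let x ∈ B_A ∖ {0} and let λ = (b_1, …, b_n) be a sequence with *-property of x. Then x(λ,i) ≁ x(λ,j) (i.e., x(λ,i) − x(λ,j) ∉ αℤ^d) for all i, j ∈ ℕ with 0 ≤ i < j ≤ n. -/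
/-- The homogeneous simplicial affine semigroup `B ⊆ ℕ^d ⊆ ℤ^d` generated by
`e_1, …, e_d, a_1, …, a_c`. -/
def semB (d c α : ℕ) (a : Fin c → Fin d → ℤ) : AddSubmonoid (Fin d → ℤ) :=
  AddSubmonoid.closure (Set.range (stdGen d α) ∪ Set.range a)

/-- The submonoid `A` generated by `e_1, …, e_d`. -/
def semA (d α : ℕ) : AddSubmonoid (Fin d → ℤ) :=
  AddSubmonoid.closure (Set.range (stdGen d α))

/-- `B_A = {x ∈ B : x - a ∉ B for all a ∈ A \ {0}}`. -/
def semBA (d c α : ℕ) (a : Fin c → Fin d → ℤ) : Set (Fin d → ℤ) :=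
  {x | x ∈ semB d c α a ∧ ∀ y ∈ semA d α, y ≠ 0 → x - y ∉ semB d c α a}

/-- A list `l = (b_1, …, b_n)` is a sequence with `*`-property of `x`: every entry is one of
the generators `e_1, …, e_d, a_1, …, a_c`, and all partial differences
`x(λ,i) = x - (b_1 + ⋯ + b_i)` lie in `B`. -/
def starSeq (d c α : ℕ) (a : Fin c → Fin d → ℤ) (x : Fin d → ℤ)
    (l : List (Fin d → ℤ)) : Prop :=
  (∀ v ∈ l, (∃ i, v = stdGen d α i) ∨ (∃ i, v = a i)) ∧
    ∀ i ≤ l.length, x - (l.take i).sum ∈ semB d c α a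


theorem list_sum_nonneg_and_sum_coords (d α : ℕ) (l : List (Fin d → ℤ))
    (h : ∀ v ∈ l, (∀ q, 0 ≤ v q) ∧ ∑ q, v q = (α : ℤ)) :
    (∀ q, 0 ≤ l.sum q) ∧ ∑ q, l.sum q = (l.length : ℤ) * α := by
  induction l with
  | nil => simp
  | cons v t ih =>
    obtain ⟨hv, ht⟩ := List.forall_mem_cons.1 h
    obtain ⟨h1, h2⟩ := ih ht
    refine ⟨fun q => ?_, ?_⟩
    · simpa using add_nonneg (hv.1 q) (h1 q)
    · simp only [List.sum_cons, Pi.add_apply, Finset.sum_add_distrib, hv.2, h2,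
        List.length_cons]
      push_cast
      ring

theorem stdGen_nonneg_and_sum (d α : ℕ) (i : Fin d) :
    (∀ q, 0 ≤ stdGen d α i q) ∧ ∑ q, stdGen d α i q = (α : ℤ) := by
  refine ⟨fun q => ?_, by simp [stdGen]⟩
  unfold stdGen
  split_ifs <;> simp

theorem mem_semA_of_nonneg_of_dvd (d α : ℕ) (hα : 0 < α) (y : Fin d → ℤ)
    (h0 : ∀ q, 0 ≤ y q) (hd : ∀ q, (α : ℤ) ∣ y q) : y ∈ semA d α := by
  choose k hk using hd
  have hα' : (0 : ℤ) < α := by exact_mod_cast hα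
  have hk0 : ∀ q, 0 ≤ k q := fun q => by
    have := h0 q
    rw [hk q] at this
    exact nonneg_of_mul_nonneg_right this hα'
  have hy : y = ∑ i, (k i).toNat • stdGen d α i := by
    funext q
    simp [Finset.sum_apply, stdGen, hk q, max_eq_left (hk0 q), mul_comm]
  rw [hy]
  exact AddSubmonoid.sum_mem _ fun i _ =>
    AddSubmonoid.nsmul_mem _ (AddSubmonoid.subset_closure (Set.mem_range_self i)) _

theorem starSeq_not_equiv (d c α : ℕ) (hd : 0 < d) (hc : 0 < c) (hα : 0 < α)
    (a : Fin c → Fin d → ℤ) (ha : ∀ i, (∀ j, 0 ≤ a i j) ∧ ∑ j, a i j = (α : ℤ))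
    (x : Fin d → ℤ) (hx : x ∈ semBA d c α a) (hx0 : x ≠ 0)
    (l : List (Fin d → ℤ)) (hl : starSeq d c α a x l) :
    ∀ i j : ℕ, i < j → j ≤ l.length →
      ¬ (∀ q : Fin d, (α : ℤ) ∣ ((x - (l.take i).sum) q - (x - (l.take j).sum) q)) := by
  intro i j hij hj hdvd
  obtain ⟨hgen, hmem⟩ := hl
  have hprop : ∀ v ∈ l, (∀ q, 0 ≤ v q) ∧ ∑ q, v q = (α : ℤ) := by
    intro v hv
    rcases hgen v hv with ⟨k, rfl⟩ | ⟨k, rfl⟩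
    · exact stdGen_nonneg_and_sum d α k
    · exact ha k
  have hB : ∀ v ∈ l, v ∈ semB d c α a := by
    intro v hv
    apply AddSubmonoid.subset_closure
    rcases hgen v hv with ⟨k, rfl⟩ | ⟨k, rfl⟩
    · exact Or.inl ⟨k, rfl⟩
    · exact Or.inr ⟨k, rfl⟩
  have hsplit : (l.take j).sum = (l.take i).sum + ((l.take j).drop i).sum := by
    conv_lhs => rw [← List.take_append_drop i (l.take j), List.sum_append, List.take_take,
      min_eq_left hij.le]
  obtain ⟨hy0, hysum⟩ := list_sum_nonneg_and_sum_coords d α ((l.take j).drop i)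
    fun v hv => hprop v (List.mem_of_mem_take (List.mem_of_mem_drop hv))
  refine hx.2 ((l.take j).drop i).sum
    (mem_semA_of_nonneg_of_dvd d α hα _ hy0 fun q => ?_) (fun h => ?_) ?_
  · have := hdvd q
    rw [hsplit] at this
    simpa using this
  · rw [h] at hysum
    have hlen : ((l.take j).drop i).length = j - i := by
      rw [List.length_drop, List.length_take, min_eq_left hj]
    rw [hlen] at hysum
    have : (0 : ℤ) < ((j - i : ℕ) : ℤ) * α := by
      have : 0 < j - i := Nat.sub_pos_of_lt hij
      positivity
    simp only [Pi.zero_apply, Finset.sum_const_zero] at hysum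
    omega
  · have h := (semB d c α a).add_mem (hmem j hj)
      (AddSubmonoid.list_sum_mem _ fun v hv => hB v (List.mem_of_mem_take hv) :
        (l.take i).sum ∈ semB d c α a)
    rw [hsplit] at h
    convert h using 1
    abel
end

section
/- Let J ⊆ {1, …, d} be nonempty and let x ∈ B_A satisfy x_q = α for all q ∈ J. Then there exists a sequence λ ∈ Λ_x with the property: for every p = 1, …, #J there exists q ∈ J such that 0 < x(λ,p)_q < α. -/
theorem eq_stdGen_of_le_apply {d α : ℕ} {v : Fin d → ℤ} (hv : ∀ j, 0 ≤ v j)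
    (hs : ∑ j, v j = (α : ℤ)) {q : Fin d} (hq : (α : ℤ) ≤ v q) : v = stdGen d α q := by
  have hsplit := Finset.add_sum_erase Finset.univ v (Finset.mem_univ q)
  have hnn : 0 ≤ ∑ j ∈ Finset.univ.erase q, v j := Finset.sum_nonneg fun j _ => hv j
  have hz : ∑ j ∈ Finset.univ.erase q, v j = 0 := by omega
  funext j
  by_cases hj : j = q
  · subst hj
    simp only [stdGen, if_true]
    omega
  · simp only [stdGen, if_neg hj]
    exact (Finset.sum_eq_zero_iff_of_nonneg fun j _ => hv j).1 hz j (by simp [hj])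

theorem list_sum_apply_nonneg {d : ℕ} {l : List (Fin d → ℤ)} (h : ∀ v ∈ l, ∀ j, 0 ≤ v j)
    (q : Fin d) : 0 ≤ l.sum q := by
  have : (0 : Fin d → ℤ) ≤ l.sum := List.sum_nonneg fun v hv j => h v hv j
  exact this q

theorem exists_mem_apply_pos {d : ℕ} {l : List (Fin d → ℤ)} {q : Fin d} (h : 0 < l.sum q) :
    ∃ v ∈ l, 0 < v q := by
  by_contra! hneg
  have : ∀ l : List (Fin d → ℤ), (∀ v ∈ l, v q ≤ 0) → l.sum q ≤ 0 := by
    intro l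
    induction l with
    | nil => simp
    | cons v l ih =>
      intro hl
      have h₁ := hl v (by simp)
      have h₂ := ih fun w hw => hl w (by simp [hw])
      simp only [List.sum_cons, Pi.add_apply]
      omega
  exact absurd (this l hneg) (by omega)

theorem sum_apply_list_sum {d : ℕ} {α : ℤ} {l : List (Fin d → ℤ)}
    (h : ∀ v ∈ l, ∑ j, v j = α) : ∑ j, l.sum j = l.length * α := by
  induction l with
  | nil => simp
  | cons v l ih =>
    have h₂ := ih fun w hw => h w (by simp [hw])
    simp only [List.sum_cons, Pi.add_apply, Finset.sum_add_distrib, h v (by simp), h₂,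
      List.length_cons]
    push_cast
    ring

theorem sum_stdGen_apply {d α : ℕ} (J : Finset (Fin d)) (j : Fin d) :
    (∑ q ∈ J, stdGen d α q) j = if j ∈ J then (α : ℤ) else 0 := by
  simp [stdGen, Finset.sum_apply]

/-- If `x ∈ B_A` has coordinate `α` on `J`, then `deg x > #J`: otherwise `x` would be
`∑ q ∈ J, e_q`, a nonzero element of `A`. -/
theorem card_mul_lt_sum {d c α : ℕ} (hα : 0 < α) {a : Fin c → Fin d → ℤ}
    {J : Finset (Fin d)} (hJ : J.Nonempty) {x : Fin d → ℤ} (hx : x ∈ semBA d c α a)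
    (hx0 : ∀ j, 0 ≤ x j) (hxJ : ∀ q ∈ J, x q = (α : ℤ)) :
    (J.card : ℤ) * α < ∑ j, x j := by
  have hsum : ∑ j ∈ J, x j = (J.card : ℤ) * α := by
    rw [Finset.sum_congr rfl hxJ]
    simp
  have hsplit := Finset.sum_add_sum_compl J x
  have hnn : 0 ≤ ∑ j ∈ Jᶜ, x j := Finset.sum_nonneg fun j _ => hx0 j
  by_contra! hle
  have hz : ∑ j ∈ Jᶜ, x j = 0 := by omega
  have hzero := (Finset.sum_eq_zero_iff_of_nonneg fun j _ => hx0 j).1 hz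
  have hxeq : x = ∑ q ∈ J, stdGen d α q := by
    funext j
    rw [sum_stdGen_apply]
    split_ifs with hj
    · exact hxJ j hj
    · exact hzero j (by simpa using hj)
  have hxA : x ∈ semA d α := by
    rw [hxeq]
    exact sum_mem fun q _ => AddSubmonoid.subset_closure ⟨q, rfl⟩
  obtain ⟨q, hq⟩ := hJ
  refine hx.2 x hxA (fun h => ?_) (by simp)
  have := hxJ q hq
  rw [h, Pi.zero_apply] at this
  omega

theorem exists_starSeq_hitting_J (d c α : ℕ) (hd : 0 < d) (hc : 0 < c) (hα : 0 < α)
    (a : Fin c → Fin d → ℤ) (ha : ∀ i, (∀ j, 0 ≤ a i j) ∧ ∑ j, a i j = (α : ℤ))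
    (J : Finset (Fin d)) (hJ : J.Nonempty)
    (x : Fin d → ℤ) (hx : x ∈ semBA d c α a) (hxJ : ∀ q ∈ J, x q = (α : ℤ)) :
    ∃ l : List (Fin d → ℤ), starSeq d c α a x l ∧ (l.length : ℤ) * (α : ℤ) = ∑ j, x j ∧
      ∀ p : ℕ, 1 ≤ p → p ≤ J.card →
        ∃ q ∈ J, 0 < (x - (l.take p).sum) q ∧ (x - (l.take p).sum) q < (α : ℤ) := by
  have hstd : ∀ i, (∀ j, 0 ≤ stdGen d α i j) ∧ ∑ j, stdGen d α i j = (α : ℤ) := fun i =>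
    ⟨fun j => by unfold stdGen; split_ifs <;> simp, by simp [stdGen]⟩
  obtain ⟨l, hl, hlx⟩ := AddSubmonoid.exists_list_of_mem_closure hx.1
  have hgen : ∀ v ∈ l, (∀ j, 0 ≤ v j) ∧ ∑ j, v j = (α : ℤ) := by
    intro v hv
    rcases hl v hv with ⟨i, rfl⟩ | ⟨i, rfl⟩
    exacts [hstd i, ha i]
  have hmem : ∀ l' : List (Fin d → ℤ), (∀ v ∈ l', v ∈ l) → l'.sum ∈ semB d c α a :=
    fun l' h => list_sum_mem fun v hv => AddSubmonoid.subset_closure (hl v (h v hv))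
  have hx0 : ∀ j, 0 ≤ x j := fun j => hlx ▸ list_sum_apply_nonneg (fun v hv => (hgen v hv).1) j
  have hcard := card_mul_lt_sum hα hJ hx hx0 hxJ
  obtain ⟨q, hq⟩ := hJ
  have hxq := hxJ q hq
  obtain ⟨v, hv, hvq⟩ := exists_mem_apply_pos (l := l) (q := q) (by rw [hlx]; omega)
  obtain ⟨l₁, hperm₁⟩ : ∃ l₁, l.Perm (v :: l₁) := ⟨_, List.perm_cons_erase hv⟩
  have hsum₁ : v + l₁.sum = x := by rw [← hlx, hperm₁.sum_eq, List.sum_cons]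
  have hvα : v q < α := by
    by_contra! hle
    have hveq := eq_stdGen_of_le_apply (hgen v hv).1 (hgen v hv).2 hle
    refine hx.2 v (hveq ▸ AddSubmonoid.subset_closure ⟨q, rfl⟩) (fun h => ?_) ?_
    · rw [h, Pi.zero_apply] at hvq
      omega
    · rw [← hsum₁, add_sub_cancel_left]
      exact hmem l₁ fun w hw => hperm₁.mem_iff.2 (by simp [hw])
  have hsum₁q : v q + l₁.sum q = x q := by rw [← hsum₁, Pi.add_apply]
  obtain ⟨w, hw, hwq⟩ := exists_mem_apply_pos (l := l₁) (q := q) (by omega)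
  obtain ⟨l₂, hperm₂⟩ : ∃ l₂, l₁.Perm (w :: l₂) := ⟨_, List.perm_cons_erase hw⟩
  have hperm : l.Perm (v :: (l₂ ++ [w])) :=
    hperm₁.trans ((hperm₂.trans (List.perm_append_singleton w l₂).symm).cons v)
  have hdiff : ∀ i, x - ((v :: (l₂ ++ [w])).take i).sum = ((v :: (l₂ ++ [w])).drop i).sum := by
    intro i
    rw [← hlx, hperm.sum_eq, ← List.sum_take_add_sum_drop _ i, add_sub_cancel_left]
  have hlen : ((v :: (l₂ ++ [w])).length : ℤ) * α = ∑ j, x j := by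
    rw [← hperm.length_eq, ← hlx, sum_apply_list_sum fun v hv => (hgen v hv).2]
  refine ⟨v :: (l₂ ++ [w]), ⟨fun u hu => ?_, fun i _ => ?_⟩, hlen, fun p hp₁ hp => ⟨q, hq, ?_⟩⟩
  · rcases hl u (hperm.mem_iff.2 hu) with ⟨i, rfl⟩ | ⟨i, rfl⟩
    exacts [Or.inl ⟨i, rfl⟩, Or.inr ⟨i, rfl⟩]
  · rw [hdiff]
    exact hmem _ fun u hu => hperm.mem_iff.2 (List.mem_of_mem_drop hu)
  · rw [← hlen] at hcard
    have hlt := lt_of_mul_lt_mul_right hcard (by positivity)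
    simp only [List.length_cons, List.length_append, List.length_nil] at hlt
    obtain ⟨k, rfl⟩ : ∃ k, p = k + 1 := ⟨p - 1, by omega⟩
    have hk : k ≤ l₂.length := by omega
    have hl₂ : ∀ u ∈ l₂, ∀ j, 0 ≤ u j := fun u hu =>
      (hgen u (hperm.mem_iff.2 (by simp [hu]))).1
    have htake := list_sum_apply_nonneg (fun u hu => hl₂ u (List.mem_of_mem_take hu)) q
      (l := l₂.take k)
    have hdrop := list_sum_apply_nonneg (fun u hu => hl₂ u (List.mem_of_mem_drop hu)) q
      (l := l₂.drop k)
    constructor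
    · rw [hdiff, List.drop_succ_cons, List.drop_append_of_le_length hk, List.sum_append,
        List.sum_singleton, Pi.add_apply]
      omega
    · rw [List.take_succ_cons, List.take_append_of_le_length hk, List.sum_cons, Pi.sub_apply,
        Pi.add_apply]
      omega
end

section
/- Let Γ be a ∼-equivalence class of B_A with Γ ⊆ box(B) and Γ ≠ {0}, and let x ∈ Γ. Then there exist j, k ∈ {1, …, d} with j ≠ k such that 0 < x_j < α and 0 < x_k < α. -/
/-- `box(B) = {x ∈ B : x_i ≤ α for all i}`. -/
def boxB (d c α : ℕ) (a : Fin c → Fin d → ℤ) : Set (Fin d → ℤ) :=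
  {x | x ∈ semB d c α a ∧ ∀ i, x i ≤ (α : ℤ)}

/-- `Γ` is an equivalence class of the relation `x ∼ y ⟺ x - y ∈ αℤ^d` restricted to `B_A`. -/
def IsClassOfBA (d c α : ℕ) (a : Fin c → Fin d → ℤ) (Γ : Set (Fin d → ℤ)) : Prop :=
  ∃ w ∈ semBA d c α a, Γ = {y ∈ semBA d c α a | ∀ j : Fin d, (α : ℤ) ∣ (y j - w j)}

/-- A nonnegative vector all of whose coordinates are divisible by `α` lies in `semA d α`. -/
theorem mem_semA_of_dvd {d α : ℕ} (hα : 0 < α) {y : Fin d → ℤ} (hy : ∀ j, 0 ≤ y j)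
    (hdvd : ∀ j, (α : ℤ) ∣ y j) : y ∈ semA d α := by
  have hα' : (0 : ℤ) < α := by exact_mod_cast hα
  have hsum : y = ∑ i, (y i / α).toNat • stdGen d α i := by
    funext j
    rw [Finset.sum_apply, Finset.sum_eq_single j]
    · have h0 : 0 ≤ y j / α := Int.ediv_nonneg (hy j) hα'.le
      simp only [Pi.smul_apply, stdGen, if_true, nsmul_eq_mul, Int.toNat_of_nonneg h0]
      exact (Int.ediv_mul_cancel (hdvd j)).symm
    · intro i _ hij
      simp [stdGen, hij.symm]
    · simp
  rw [hsum]
  exact sum_mem fun i _ => nsmul_mem (AddSubmonoid.subset_closure (Set.mem_range_self i)) _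

/-- Elements of `semB d c α a` have nonnegative coordinates and coordinate sum divisible by `α`. -/
theorem nonneg_and_dvd_sum_of_mem_semB {d c α : ℕ} {a : Fin c → Fin d → ℤ}
    (ha : ∀ i, (∀ j, 0 ≤ a i j) ∧ ∑ j, a i j = (α : ℤ)) {y : Fin d → ℤ}
    (hy : y ∈ semB d c α a) : (∀ j, 0 ≤ y j) ∧ (α : ℤ) ∣ ∑ j, y j := by
  induction hy using AddSubmonoid.closure_induction with
  | mem z hz =>
    rcases hz with ⟨i, rfl⟩ | ⟨i, rfl⟩
    · refine ⟨fun j => ?_, ?_⟩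
      · unfold stdGen
        split_ifs <;> simp
      · simp [stdGen]
    · exact ⟨(ha i).1, (ha i).2 ▸ dvd_rfl⟩
  | zero => simp
  | add u v _ _ hu hv =>
    refine ⟨fun j => add_nonneg (hu.1 j) (hv.1 j), ?_⟩
    simpa [Finset.sum_add_distrib] using dvd_add hu.2 hv.2

/-- The only element of `semBA d c α a` with all coordinates divisible by `α` is `0`. -/
theorem eq_zero_of_mem_semBA_of_dvd {d c α : ℕ} (hα : 0 < α) {a : Fin c → Fin d → ℤ}
    (ha : ∀ i, (∀ j, 0 ≤ a i j) ∧ ∑ j, a i j = (α : ℤ)) {y : Fin d → ℤ}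
    (hy : y ∈ semBA d c α a) (hdvd : ∀ j, (α : ℤ) ∣ y j) : y = 0 := by
  by_contra hne
  refine hy.2 y (mem_semA_of_dvd hα (nonneg_and_dvd_sum_of_mem_semB ha hy.1).1 hdvd) hne ?_
  rw [sub_self]
  exact zero_mem _

theorem class_two_fractional_coords (d c α : ℕ) (hd : 0 < d) (hc : 0 < c) (hα : 0 < α)
    (a : Fin c → Fin d → ℤ) (ha : ∀ i, (∀ j, 0 ≤ a i j) ∧ ∑ j, a i j = (α : ℤ))
    (Γ : Set (Fin d → ℤ)) (hΓ : IsClassOfBA d c α a Γ) (hbox : Γ ⊆ boxB d c α a)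
    (hΓ0 : Γ ≠ {0}) (x : Fin d → ℤ) (hxΓ : x ∈ Γ) :
    ∃ j k : Fin d, j ≠ k ∧ 0 < x j ∧ x j < (α : ℤ) ∧ 0 < x k ∧ x k < (α : ℤ) := by
  obtain ⟨hxB, hxle⟩ := hbox hxΓ
  obtain ⟨hx0, hxsum⟩ := nonneg_and_dvd_sum_of_mem_semB ha hxB
  have hfrac : ∀ j, ¬ (α : ℤ) ∣ x j → 0 < x j ∧ x j < (α : ℤ) := fun j hj =>
    ⟨(hx0 j).lt_of_ne fun h => hj (h ▸ dvd_zero _),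
      (hxle j).lt_of_ne fun h => hj (h ▸ dvd_rfl)⟩
  obtain ⟨j, hj⟩ : ∃ j, ¬ (α : ℤ) ∣ x j := by
    by_contra! hall
    obtain ⟨w, -, rfl⟩ := hΓ
    refine hΓ0 (Set.eq_singleton_iff_nonempty_unique_mem.2 ⟨⟨x, hxΓ⟩, fun y hy => ?_⟩)
    refine eq_zero_of_mem_semBA_of_dvd hα ha hy.1 fun j => ?_
    have hw : (α : ℤ) ∣ w j := (dvd_sub_right (hall j)).1 (hxΓ.2 j)
    exact (dvd_sub_left hw).1 (hy.2 j)
  obtain ⟨k, hkj, hk⟩ : ∃ k, k ≠ j ∧ ¬ (α : ℤ) ∣ x k := by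
    by_contra! hall
    rw [← Finset.add_sum_erase _ _ (Finset.mem_univ j)] at hxsum
    exact hj ((dvd_add_left (Finset.dvd_sum fun k hk =>
      hall k (Finset.ne_of_mem_erase hk))).1 hxsum)
  exact ⟨j, k, hkj.symm, (hfrac j hj).1, (hfrac j hj).2, hfrac k hk⟩
end

section
/- Suppose B_A ⊆ box(B) (equivalently, B is seminormal). Then deg x ≤ d − 1 for every x ∈ B_A; that is, the reduction number red(K[B]) := max{deg x : x ∈ B_A} satisfies red(K[B]) ≤ d − 1. -/
theorem const_mem_semA (d α : ℕ) : (fun _ => (α : ℤ)) ∈ semA d α := by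
  have h : (fun _ => (α : ℤ)) = ∑ i, stdGen d α i := by
    funext j
    simp [stdGen]
  rw [h]
  exact sum_mem fun i _ => AddSubmonoid.subset_closure ⟨i, rfl⟩

theorem const_notMem_semBA (d c α : ℕ) (hd : 0 < d) (hα : 0 < α) (a : Fin c → Fin d → ℤ) :
    (fun _ => (α : ℤ)) ∉ semBA d c α a := by
  intro h
  refine h.2 _ (const_mem_semA d α) (fun h0 => ?_) ?_
  · have := congrFun h0 ⟨0, hd⟩
    simp only [Pi.zero_apply] at this
    omega
  · rw [sub_self]
    exact zero_mem _

theorem red_le_dim_sub_one_of_BA_subset_box (d c α : ℕ) (hd : 0 < d) (hc : 0 < c) (hα : 0 < α)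
    (a : Fin c → Fin d → ℤ) (ha : ∀ i, (∀ j, 0 ≤ a i j) ∧ ∑ j, a i j = (α : ℤ))
    (hsn : semBA d c α a ⊆ boxB d c α a) :
    ∀ x ∈ semBA d c α a, ∀ r : ℤ, ∑ j, x j = r * (α : ℤ) → r ≤ (d : ℤ) - 1 := by
  intro x hx r hr
  have hbox := (hsn hx).2
  have hne : ∃ i, x i < (α : ℤ) := by
    by_contra! h
    have hconst : x = fun _ => (α : ℤ) := funext fun i => le_antisymm (hbox i) (h i)
    exact const_notMem_semBA d c α hd hα a (hconst ▸ hx)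
  obtain ⟨i, hi⟩ := hne
  have hlt : ∑ j, x j < ∑ _j : Fin d, (α : ℤ) :=
    Finset.sum_lt_sum (fun j _ => hbox j) ⟨i, Finset.mem_univ i, hi⟩
  rw [hr, Finset.sum_const, Finset.card_univ, Fintype.card_fin, nsmul_eq_mul] at hlt
  have := lt_of_mul_lt_mul_right hlt (Int.natCast_nonneg α)
  omega
end

section
/- Let Γ be a ∼-equivalence class of B_A with Γ ⊆ box(B), let h ∈ ℕ^d be the coordinatewise minimum of Γ (h_i = min{m_i : m ∈ Γ}), and let n ∈ Γ. Then: (1) for every q ∈ {1, …, d} such that n_q = h_q but y_q > h_q for some y ∈ Γ, one has n_q = 0; (2) for every q ∈ {1, …, d} with n_q > h_q, one has n_q = α. (Equivalently, with m the squarefree monomial corresponding to n in the Hoa–Stückrad decomposition: n_q = 0 for all q ∈ supp(I_t) ∖ supp(mT) and n_q = α for all q ∈ supp(mT).) -/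
theorem semB_nonneg {d c α : ℕ} {a : Fin c → Fin d → ℤ} (ha : ∀ i j, 0 ≤ a i j)
    {x : Fin d → ℤ} (hx : x ∈ semB d c α a) (q : Fin d) : 0 ≤ x q := by
  induction hx using AddSubmonoid.closure_induction with
  | mem x hx =>
    rcases hx with ⟨i, rfl⟩ | ⟨i, rfl⟩
    · unfold stdGen
      split_ifs <;> simp
    · exact ha i q
  | zero => exact le_rfl
  | add x y _ _ hx hy => exact add_nonneg hx hy

theorem class_member_coords_extreme (d c α : ℕ) (hd : 0 < d) (hc : 0 < c) (hα : 0 < α)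
    (a : Fin c → Fin d → ℤ) (ha : ∀ i, (∀ j, 0 ≤ a i j) ∧ ∑ j, a i j = (α : ℤ))
    (Γ : Set (Fin d → ℤ)) (hΓ : IsClassOfBA d c α a Γ) (hbox : Γ ⊆ boxB d c α a)
    (h : Fin d → ℤ) (hmin : ∀ i : Fin d, IsLeast {v : ℤ | ∃ x ∈ Γ, x i = v} (h i))
    (n : Fin d → ℤ) (hn : n ∈ Γ) :
    (∀ q : Fin d, n q = h q → (∃ y ∈ Γ, h q < y q) → n q = 0) ∧
      (∀ q : Fin d, h q < n q → n q = (α : ℤ)) := by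
  have key : ∀ x ∈ Γ, ∀ q, h q < x q → h q = 0 ∧ x q = (α : ℤ) := by
    intro x hx q hlt
    obtain ⟨y, hy, hyq⟩ := (hmin q).1
    obtain ⟨w, -, rfl⟩ := hΓ
    have hdvd : (α : ℤ) ∣ x q - y q := by
      simpa using dvd_sub (hx.2 q) (hy.2 q)
    have hle := Int.le_of_dvd (by omega) hdvd
    have hx_le := (hbox hx).2 q
    have hy_nonneg := semB_nonneg (fun i => (ha i).1) hy.1.1 q
    omega
  refine ⟨?_, fun q hq => (key n hn q hq).2⟩
  rintro q hq ⟨y, hy, hlt⟩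
  exact hq.trans (key y hy q hlt).1
end
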